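/- Let Φ be a CNF formula with variables x_1,…,x_s (s ≥ 1) and clauses c_1,…,c_t. Then the maximum order of a rainbow tree in the edge-colored graph G_Φ equals 2s plus the maximum number of clauses of Φ that can be simultaneously satisfied by a truth assignment of x_1,…,x_s. -/

import Mathlib

/-!
Edge-colored graph `G_Φ` associated with a CNF formula `Φ` with variables
`x_1, …, x_s` and clauses `c_1, …, c_t`.  Variables are indexed by `0, …, s-1`
and clauses by `0, …, t-1`.  The formula is given by two occurrence relations
`pos` and `neg`: `pos j i` means the positive literal `x_i` occurs in clause
`c_j`, and `neg j i` means the negative literal `¬x_i` occurs in clause `c_j`.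
-/

namespace Stmt2

/-- Vertices of `G_Φ`: `y i`, `a1 i`, `a2 i` for each variable index `i`,
and `cl j` for each clause index `j`. -/
inductive Vtx where
  | y (i : ℕ)
  | a1 (i : ℕ)
  | a2 (i : ℕ)
  | cl (j : ℕ)
deriving DecidableEq

/-- Colors: `b i` and `d i` for variable indices, `C j` for clause indices.
Distinct constructors/indices give pairwise distinct colors. -/
inductive Col where
  | b (i : ℕ)
  | C (j : ℕ)
  | d (i : ℕ)
deriving DecidableEq

/-- The set of edges of `G_Φ` receiving a given color. -/
def colorClass (s t : ℕ) (pos neg : ℕ → ℕ → Prop) : Col → Set (Sym2 Vtx)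
  | .b i => {e | i < s ∧ (e = s(Vtx.y i, Vtx.a1 i) ∨ e = s(Vtx.y i, Vtx.a2 i))}
  | .d i => {e | i + 1 < s ∧ e = s(Vtx.y i, Vtx.y (i + 1))}
  | .C j => {e | j < t ∧ ∃ i < s,
      (pos j i ∧ e = s(Vtx.cl j, Vtx.a1 i)) ∨ (neg j i ∧ e = s(Vtx.cl j, Vtx.a2 i))}

/-- The graph `G_Φ`. -/
def GPhi (s t : ℕ) (pos neg : ℕ → ℕ → Prop) : SimpleGraph Vtx :=
  SimpleGraph.fromEdgeSet (⋃ col, colorClass s t pos neg col)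

/-- A set of edges is rainbow if it contains at most one edge of each color. -/
def Rainbow (s t : ℕ) (pos neg : ℕ → ℕ → Prop) (E : Set (Sym2 Vtx)) : Prop :=
  ∀ col : Col, ∀ e ∈ E, ∀ f ∈ E,
    e ∈ colorClass s t pos neg col → f ∈ colorClass s t pos neg col → e = f

/-- The truth assignment `α` satisfies clause `c_j`. -/
def SatClause (s : ℕ) (pos neg : ℕ → ℕ → Prop) (α : ℕ → Bool) (j : ℕ) : Prop :=
  ∃ i < s, (pos j i ∧ α i = true) ∨ (neg j i ∧ α i = false)

/-- Distinct colors have disjoint color classes. -/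
lemma eq_of_mem_colorClass {s t : ℕ} {pos neg : ℕ → ℕ → Prop} {c c' : Col} {e : Sym2 Vtx}
    (h : e ∈ colorClass s t pos neg c) (h' : e ∈ colorClass s t pos neg c') : c = c' := by
  cases c <;> cases c' <;> simp only [colorClass, Set.mem_ofPred_eq] at h h' <;> grind

lemma exists_mem_colorClass {s t : ℕ} {pos neg : ℕ → ℕ → Prop} {u v : Vtx}
    (h : (GPhi s t pos neg).Adj u v) : ∃ c, s(u, v) ∈ colorClass s t pos neg c := by
  simpa using ((SimpleGraph.fromEdgeSet_adj _).1 h).1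

lemma ne_of_mem_colorClass {s t : ℕ} {pos neg : ℕ → ℕ → Prop} {c : Col} {u v : Vtx}
    (h : s(u, v) ∈ colorClass s t pos neg c) : u ≠ v := by
  cases c <;> simp only [colorClass, Set.mem_ofPred_eq] at h <;> grind

/-- The colors of `G_Φ`, with the clause colors restricted to `S`. -/
def colors (s : ℕ) (S : Set ℕ) : Set Col :=
  Col.b '' Set.Iio s ∪ Col.d '' Set.Iio (s - 1) ∪ Col.C '' S

lemma ncard_colors_le (s : ℕ) {S : Set ℕ} (hS : S.Finite) :
    (colors s S).ncard ≤ s + (s - 1) + S.ncard := by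
  have h1 := Set.ncard_image_le (f := Col.b) (Set.finite_Iio s)
  have h2 := Set.ncard_image_le (f := Col.d) (Set.finite_Iio (s - 1))
  have h3 := Set.ncard_image_le (f := Col.C) hS
  have h4 := Set.ncard_union_le (Col.b '' Set.Iio s) (Col.d '' Set.Iio (s - 1))
  have h5 := Set.ncard_union_le (Col.b '' Set.Iio s ∪ Col.d '' Set.Iio (s - 1)) (Col.C '' S)
  simp only [Set.ncard_Iio_nat] at h1 h2
  unfold colors
  omega

lemma finite_colors (s : ℕ) {S : Set ℕ} (hS : S.Finite) : (colors s S).Finite :=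
  (((Set.finite_Iio s).image _).union ((Set.finite_Iio (s - 1)).image _)).union (hS.image _)

/-- A rainbow set of edges of `G_Φ` has at most as many edges as there are available colors. -/
lemma Rainbow.ncard_le {s t : ℕ} {pos neg : ℕ → ℕ → Prop} {T : (GPhi s t pos neg).Subgraph}
    (hT : Rainbow s t pos neg T.edgeSet) {S : Set ℕ} (hS : S.Finite)
    (hC : ∀ j, ∀ e ∈ T.edgeSet, e ∈ colorClass s t pos neg (.C j) → j ∈ S) :
    T.edgeSet.ncard ≤ s + (s - 1) + S.ncard := by
  have hcol : ∀ e ∈ T.edgeSet, ∃ c, e ∈ colorClass s t pos neg c := by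
    intro e he
    induction e with
    | h u v => exact exists_mem_colorClass (T.adj_sub he)
  have : Nonempty Col := ⟨.b 0⟩
  choose! f hf using hcol
  refine (Set.ncard_le_ncard_of_injOn f ?_ ?_ (finite_colors s hS)).trans (ncard_colors_le s hS)
  · intro e he
    have h := hf e he
    have h' := fun j => hC j e he
    cases hc : f e with
    | b i => rw [hc] at h; exact .inl (.inl ⟨i, h.1, rfl⟩)
    | d i => rw [hc] at h; exact .inl (.inr ⟨i, by have := h.1; simp; omega, rfl⟩)
    | C j => rw [hc] at h; exact .inr ⟨j, h' j h, rfl⟩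
  · intro e he e' he' h
    exact hT (f e) e he e' he' (hf e he) (h ▸ hf e' he')

lemma card_coe_edgeSet {V : Type*} {G : SimpleGraph V} (T : G.Subgraph) :
    Nat.card T.coe.edgeSet = T.edgeSet.ncard := by
  rw [← T.image_coe_edgeSet_coe,
    Set.ncard_image_of_injective _ (Sym2.map.injective Subtype.val_injective),
    Nat.card_coe_set_eq]

/-- A set of vertices closed under adjacency that meets a connected subgraph contains it. -/
lemma mem_of_connected {V : Type*} {G : SimpleGraph V} {T : G.Subgraph} (hT : T.coe.Connected)
    {S : Set V} (hS : ∀ u ∈ S, ∀ v, T.Adj u v → v ∈ S) {u v : V} (hu : u ∈ T.verts)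
    (hv : v ∈ T.verts) (huS : u ∈ S) : v ∈ S := by
  obtain ⟨p⟩ := hT.preconnected ⟨u, hu⟩ ⟨v, hv⟩
  have key : ∀ {a b : T.verts}, T.coe.Walk a b → (a : V) ∈ S → (b : V) ∈ S := by
    intro a b p
    induction p with
    | nil => exact id
    | cons h _ ih => exact fun ha => ih (hS _ ha _ h)
  exact key p huS

/-- If the edge from `v` to `y i` is absent, then a connected rainbow subgraph containing the
literal vertex `v` of `x_i` is a star centered at `v`. -/
lemma star_of_not_adj {s t : ℕ} {pos neg : ℕ → ℕ → Prop} {T : (GPhi s t pos neg).Subgraph}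
    (hT : T.coe.Connected) (hR : Rainbow s t pos neg T.edgeSet) {i : ℕ} {v : Vtx}
    (hv : v = .a1 i ∨ v = .a2 i) (hvT : v ∈ T.verts) (hy : ¬ T.Adj v (.y i)) {w : Vtx}
    (hw : w ∈ T.verts) : w = v ∨ ∃ j, w = .cl j := by
  have key := mem_of_connected hT (S := {w | w = v ∨ T.Adj v w ∧ ∃ j, w = .cl j}) ?_ hvT hw
    (Or.inl rfl)
  · exact key.imp_right And.right
  rintro u (rfl | ⟨huv, j, rfl⟩) w huw
  · refine .inr ⟨huw, ?_⟩
    obtain ⟨c, hc⟩ := exists_mem_colorClass (T.adj_sub huw)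
    cases c <;> simp only [colorClass, Set.mem_ofPred_eq] at hc <;> grind
  · left
    have hCl : ∀ w, T.Adj (.cl j) w → s(.cl j, w) ∈ colorClass s t pos neg (.C j) := by
      intro w hw
      obtain ⟨c, hc⟩ := exists_mem_colorClass (T.adj_sub hw)
      have : c = .C j := by
        cases c <;> simp only [colorClass, Set.mem_ofPred_eq] at hc <;> grind
      exact this ▸ hc
    have := hR (.C j) _ huw _ huv.symm (hCl w huw) (hCl v huv.symm)
    grind

/-- A connected rainbow subgraph contains at most one of the two literal vertices
of each variable. -/
lemma not_both_literals {s t : ℕ} {pos neg : ℕ → ℕ → Prop} {T : (GPhi s t pos neg).Subgraph}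
    (hT : T.coe.Connected) (hR : Rainbow s t pos neg T.edgeSet) {i : ℕ} (hi : i < s)
    (h1 : .a1 i ∈ T.verts) (h2 : .a2 i ∈ T.verts) : False := by
  by_cases h1y : T.Adj (.a1 i) (.y i)
  · by_cases h2y : T.Adj (.a2 i) (.y i)
    · have := hR (.b i) _ h1y.symm _ h2y.symm ⟨hi, .inl rfl⟩ ⟨hi, .inr rfl⟩
      grind
    · have := star_of_not_adj hT hR (.inr rfl) h2 h2y h1
      grind
  · have := star_of_not_adj hT hR (.inl rfl) h1 h1y h2
    grind

lemma finite_setOf_satClause (s t : ℕ) (pos neg : ℕ → ℕ → Prop) (α : ℕ → Bool) :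
    {j | j < t ∧ SatClause s pos neg α j}.Finite :=
  (Set.finite_Iio t).subset fun _ h => h.1

lemma exists_assignment_of_connected {s t : ℕ} (hs : 1 ≤ s) {pos neg : ℕ → ℕ → Prop}
    {T : (GPhi s t pos neg).Subgraph} (hT : T.coe.Connected)
    (hR : Rainbow s t pos neg T.edgeSet) :
    ∃ α : ℕ → Bool, T.verts.ncard ≤ 2 * s + {j | j < t ∧ SatClause s pos neg α j}.ncard := by
  classical
  refine ⟨fun i => decide (Vtx.a1 i ∈ T.verts), ?_⟩
  have h1 := hT.card_vert_le_card_edgeSet_add_one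
  rw [card_coe_edgeSet, Nat.card_coe_set_eq] at h1
  have h2 := hR.ncard_le (finite_setOf_satClause s t pos neg fun i => decide (Vtx.a1 i ∈ T.verts))
    ?_
  · omega
  rintro j e he ⟨hj, i, hi, ⟨hp, rfl⟩ | ⟨hn, rfl⟩⟩
  · exact ⟨hj, i, hi, .inl ⟨hp, by simpa using T.edge_vert (T.adj_symm he)⟩⟩
  · exact ⟨hj, i, hi, .inr ⟨hn, by
      simpa using fun h => not_both_literals hT hR hi h (T.edge_vert (T.adj_symm he))⟩⟩

/-- The vertex of the literal of `x_i` made true by `α`. -/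
def lit (α : ℕ → Bool) (i : ℕ) : Vtx := if α i = true then .a1 i else .a2 i

/-- The edge of each color in the tree given by `α`, where clause `j` is joined to the true
literal of its witness variable `w j`. -/
def treeEdge (α : ℕ → Bool) (w : ℕ → ℕ) : Col → Sym2 Vtx
  | .b i => s(.y i, lit α i)
  | .d i => s(.y i, .y (i + 1))
  | .C j => s(.cl j, lit α (w j))

/-- The vertices of the tree given by `α` and a set `S` of clauses. -/
def treeVerts (s : ℕ) (α : ℕ → Bool) (S : Set ℕ) : Set Vtx :=
  Vtx.y '' Set.Iio s ∪ lit α '' Set.Iio s ∪ Vtx.cl '' S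

lemma lit_injective (α : ℕ → Bool) : Function.Injective (lit α) := by
  intro i j h
  unfold lit at h
  grind

lemma ncard_treeVerts (s : ℕ) (α : ℕ → Bool) {S : Set ℕ} (hS : S.Finite) :
    (treeVerts s α S).ncard = 2 * s + S.ncard := by
  have hy := (Set.finite_Iio s).image Vtx.y
  have hl := (Set.finite_Iio s).image (lit α)
  unfold treeVerts
  rw [Set.ncard_union_eq ?_ (hy.union hl) (hS.image _), Set.ncard_union_eq ?_ hy hl,
    Set.ncard_image_of_injective _ (lit_injective α),
    Set.ncard_image_of_injective _ (fun i j h => by simpa using h),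
    Set.ncard_image_of_injective _ (fun i j h => by simpa using h), Set.ncard_Iio_nat]
  · omega
  · rw [Set.disjoint_left]
    rintro _ ⟨i, -, rfl⟩ ⟨j, -, h⟩
    unfold lit at h
    grind
  · rw [Set.disjoint_left]
    rintro _ (⟨i, -, rfl⟩ | ⟨i, -, rfl⟩) ⟨j, -, h⟩ <;> unfold lit at * <;> grind

lemma exists_rainbow_tree {s : ℕ} (t : ℕ) (hs : 1 ≤ s) (pos neg : ℕ → ℕ → Prop) (α : ℕ → Bool) :
    ∃ T : (GPhi s t pos neg).Subgraph, T.coe.IsTree ∧ Rainbow s t pos neg T.edgeSet ∧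
      T.verts.ncard = 2 * s + {j | j < t ∧ SatClause s pos neg α j}.ncard := by
  set S := {j | j < t ∧ SatClause s pos neg α j} with hSdef
  have hS : S.Finite := finite_setOf_satClause s t pos neg α
  have hw : ∀ j ∈ S, ∃ i, i < s ∧ ((pos j i ∧ α i = true) ∨ (neg j i ∧ α i = false)) :=
    fun j hj => hj.2
  choose! w hws hw using hw
  have hcol : ∀ c ∈ colors s S, treeEdge α w c ∈ colorClass s t pos neg c := by
    rintro _ ((⟨i, hi, rfl⟩ | ⟨i, hi, rfl⟩) | ⟨j, hj, rfl⟩)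
    · refine ⟨hi, ?_⟩
      simp only [treeEdge, lit]
      split_ifs <;> simp
    · exact ⟨by simp at hi; omega, rfl⟩
    · refine ⟨hj.1, w j, hws j hj, ?_⟩
      rcases hw j hj with ⟨h, h'⟩ | ⟨h, h'⟩
      · exact .inl ⟨h, by simp [treeEdge, lit, h']⟩
      · exact .inr ⟨h, by simp [treeEdge, lit, h']⟩
  have hvert : ∀ c ∈ colors s S, ∀ v ∈ treeEdge α w c, v ∈ treeVerts s α S := by
    rintro _ ((⟨i, hi, rfl⟩ | ⟨i, hi, rfl⟩) | ⟨j, hj, rfl⟩) v hv <;>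
      rcases Sym2.mem_iff.1 hv with rfl | rfl
    · exact .inl (.inl ⟨i, hi, rfl⟩)
    · exact .inl (.inr ⟨i, hi, rfl⟩)
    · exact .inl (.inl ⟨i, by simp at hi ⊢; omega, rfl⟩)
    · exact .inl (.inl ⟨i + 1, by simp at hi ⊢; omega, rfl⟩)
    · exact .inr ⟨j, hj, rfl⟩
    · exact .inl (.inr ⟨w j, hws j hj, rfl⟩)
  let T : (GPhi s t pos neg).Subgraph :=
    { verts := treeVerts s α S
      Adj := fun u v => s(u, v) ∈ treeEdge α w '' colors s S
      adj_sub := by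
        rintro u v ⟨c, hc, he⟩
        have h := he ▸ hcol c hc
        exact (SimpleGraph.fromEdgeSet_adj _).2
          ⟨Set.mem_iUnion.2 ⟨c, h⟩, ne_of_mem_colorClass h⟩
      edge_vert := by
        rintro u v ⟨c, hc, he⟩
        exact hvert c hc u (he ▸ Sym2.mem_mk_left u v)
      symm := ⟨fun u v h => by rwa [Sym2.eq_swap]⟩ }
  have hE : ∀ e ∈ T.edgeSet, ∃ c ∈ colors s S, treeEdge α w c = e := by
    intro e he
    induction e with
    | h u v => exact he
  have hR : Rainbow s t pos neg T.edgeSet := by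
    intro c e he f hf hec hfc
    obtain ⟨c₁, h₁, rfl⟩ := hE e he
    obtain ⟨c₂, h₂, rfl⟩ := hE f hf
    rw [eq_of_mem_colorClass (hcol c₁ h₁) hec, eq_of_mem_colorClass (hcol c₂ h₂) hfc]
  have hcard : T.verts.ncard = 2 * s + S.ncard := ncard_treeVerts s α hS
  have hyT : ∀ i, i < s → Vtx.y i ∈ T.verts := fun i hi => .inl (.inl ⟨i, hi, rfl⟩)
  have hlT : ∀ i, i < s → lit α i ∈ T.verts := fun i hi => .inl (.inr ⟨i, hi, rfl⟩)
  have hy : ∀ i (hi : i < s), T.coe.Reachable ⟨.y 0, hyT 0 hs⟩ ⟨.y i, hyT i hi⟩ := by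
    intro i
    induction i with
    | zero => exact fun _ => .refl _
    | succ i ih =>
      intro hi
      refine (ih (by omega)).trans (SimpleGraph.Adj.reachable ?_)
      exact ⟨.d i, .inl (.inr ⟨i, by simp; omega, rfl⟩), rfl⟩
  have hl : ∀ i (hi : i < s), T.coe.Reachable ⟨.y 0, hyT 0 hs⟩ ⟨lit α i, hlT i hi⟩ := by
    intro i hi
    refine (hy i hi).trans (SimpleGraph.Adj.reachable ?_)
    exact ⟨.b i, .inl (.inl ⟨i, hi, rfl⟩), rfl⟩
  have hconn : T.coe.Connected := by
    refine (SimpleGraph.connected_iff_exists_forall_reachable _).2 ⟨⟨.y 0, hyT 0 hs⟩, ?_⟩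
    rintro ⟨_, (⟨i, hi, rfl⟩ | ⟨i, hi, rfl⟩) | ⟨j, hj, rfl⟩⟩
    · exact hy i hi
    · exact hl i hi
    · refine (hl (w j) (hws j hj)).trans (SimpleGraph.Adj.reachable (SimpleGraph.Adj.symm ?_))
      exact ⟨.C j, .inr ⟨j, hj, rfl⟩, rfl⟩
  have hfin : Finite T.verts := (Set.finite_of_ncard_pos (by omega)).to_subtype
  refine ⟨T, SimpleGraph.isTree_iff_connected_and_card.2 ⟨hconn, ?_⟩, hR, hcard⟩
  have h1 := hconn.card_vert_le_card_edgeSet_add_one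
  rw [card_coe_edgeSet, Nat.card_coe_set_eq] at *
  have h2 := hR.ncard_le hS ?_
  · omega
  intro j e he hej
  obtain ⟨c, hc, rfl⟩ := hE e he
  obtain rfl := eq_of_mem_colorClass (hcol c hc) hej
  simpa [colors] using hc

/-- The maximum order of a rainbow tree in `G_Φ` equals `2s` plus the maximum
number of clauses of `Φ` simultaneously satisfiable by a truth assignment. -/
theorem max_rainbow_tree_eq (s t : ℕ) (hs : 1 ≤ s) (pos neg : ℕ → ℕ → Prop) :
    sSup {n : ℕ | ∃ T : (GPhi s t pos neg).Subgraph,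
        T.coe.IsTree ∧ Rainbow s t pos neg T.edgeSet ∧ T.verts.ncard = n}
      = 2 * s +
        sSup {q : ℕ | ∃ α : ℕ → Bool, {j | j < t ∧ SatClause s pos neg α j}.ncard = q} := by
  have hbdd : BddAbove {q : ℕ | ∃ α : ℕ → Bool,
      {j | j < t ∧ SatClause s pos neg α j}.ncard = q} := by
    refine ⟨t, ?_⟩
    rintro _ ⟨α, rfl⟩
    simpa using Set.ncard_le_ncard (t := Set.Iio t) (fun j hj => hj.1) (Set.finite_Iio t)
  have hupper : 2 * s + sSup {q : ℕ | ∃ α : ℕ → Bool,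
        {j | j < t ∧ SatClause s pos neg α j}.ncard = q} ∈
      upperBounds {n : ℕ | ∃ T : (GPhi s t pos neg).Subgraph,
        T.coe.IsTree ∧ Rainbow s t pos neg T.edgeSet ∧ T.verts.ncard = n} := by
    rintro _ ⟨T, hT, hR, rfl⟩
    obtain ⟨α, hα⟩ := exists_assignment_of_connected hs hT.connected hR
    exact hα.trans (Nat.add_le_add_left (le_csSup hbdd ⟨α, rfl⟩) _)
  refine le_antisymm (csSup_le' hupper) ?_
  obtain ⟨α, hα⟩ := Nat.sSup_mem (by exact ⟨_, fun _ => true, rfl⟩) hbdd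
  rw [← hα]
  exact le_csSup ⟨_, hupper⟩ (exists_rainbow_tree t hs pos neg α)

end Stmt2
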